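/- Let p, q ≥ 2 be integers with p odd or q odd, let G_{p,q} = ⟨x, y | x^p = y^q⟩, and let τ be the automorphism with τ(x) = x⁻¹, τ(y) = y⁻¹. If g ∈ G_{p,q} satisfies g·τ(g) = 1 (i.e. ι_g ∘ τ has finite order), then the fixed subgroup of ι_g ∘ τ is trivial: the only h ∈ G_{p,q} with g·τ(h)·g⁻¹ = h is h = 1. -/

import Mathlib

/-- The torus knot group `⟨x, y | x^p = y^q⟩`, as the presented group obtained as the
quotient of the free group on two generators by the normal closure of `a^p * b^(-q)`. -/
def TKG (p q : ℕ) : Type :=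
  PresentedGroup ({FreeGroup.of true ^ p * (FreeGroup.of false ^ q)⁻¹} : Set (FreeGroup Bool))

instance TKG.instGroup (p q : ℕ) : Group (TKG p q) := by
  delta TKG; infer_instance

/-- The generator `x` of the torus knot group. -/
def TKx (p q : ℕ) : TKG p q := PresentedGroup.of true

/-- The generator `y` of the torus knot group. -/
def TKy (p q : ℕ) : TKG p q := PresentedGroup.of false


section TKAux

open Monoid

section Core

variable {M : Bool → Type} [∀ i, CommGroup (M i)]

/-- reduced lists of letters -/
def TKRed (L : List (Σ i, M i)) : Prop :=
  (∀ l ∈ L, l.2 ≠ 1) ∧ L.IsChain (fun l l' => l.1 ≠ l'.1)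

/-- product of a list of letters -/
def TKP (L : List (Σ i, M i)) : CoprodI M := (L.map fun l => CoprodI.of l.2).prod

/-- invert a letter -/
def TKinv (l : Σ i, M i) : Σ i, M i := ⟨l.1, l.2⁻¹⟩

theorem TKinv_inj : Function.Injective (TKinv (M := M)) := by
  rintro ⟨i, a⟩ ⟨k, b⟩ h
  simp only [TKinv, Sigma.mk.injEq] at h
  obtain ⟨rfl, h⟩ := h
  simpa using h

theorem TK_exists_red (g : CoprodI M) : ∃ L : List (Σ i, M i), TKRed L ∧ TKP L = g := by
  classical
  refine ⟨(CoprodI.Word.equiv g).toList, ⟨(CoprodI.Word.equiv g).ne_one,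
    (CoprodI.Word.equiv g).chain_ne⟩, ?_⟩
  exact CoprodI.Word.equiv.symm_apply_apply g

theorem TK_red_inj {L L' : List (Σ i, M i)} (h : TKRed L) (h' : TKRed L')
    (e : TKP L = TKP L') : L = L' := by
  classical
  have : (⟨L, h.1, h.2⟩ : CoprodI.Word M) = ⟨L', h'.1, h'.2⟩ :=
    CoprodI.Word.equiv.symm.injective e
  exact congrArg CoprodI.Word.toList this

theorem TK_red_inv {L : List (Σ i, M i)} (h : TKRed L) : TKRed (L.map TKinv) := by
  refine ⟨?_, ?_⟩
  · intro l hl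
    obtain ⟨⟨i, a⟩, ha, rfl⟩ := List.mem_map.1 hl
    exact inv_ne_one.2 (h.1 _ ha)
  · rw [List.isChain_map]
    exact h.2

theorem TK_red_rev {L : List (Σ i, M i)} (h : TKRed L) : TKRed L.reverse := by
  refine ⟨fun l hl => h.1 l (List.mem_reverse.1 hl), ?_⟩
  rw [List.isChain_reverse]
  exact h.2.imp fun a b hab => Ne.symm hab

theorem TKP_inv (L : List (Σ i, M i)) : TKP (L.map TKinv).reverse = (TKP L)⁻¹ := by
  induction L with
  | nil => simp [TKP]
  | cons a L ih =>
    simp only [TKP, List.map_cons, List.reverse_cons, List.map_append, List.prod_append,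
      List.prod_cons, mul_inv_rev, List.map_nil, List.prod_nil, mul_one] at ih ⊢
    rw [ih]
    exact congrArg _ (map_inv _ _)

theorem TKP_T (T : CoprodI M →* CoprodI M)
    (hT : ∀ i (m : M i), T (CoprodI.of m) = CoprodI.of m⁻¹) (L : List (Σ i, M i)) :
    TKP (L.map TKinv) = T (TKP L) := by
  induction L with
  | nil => simp [TKP]
  | cons a L ih =>
    simp only [TKP, List.map_cons, List.prod_cons, map_mul] at ih ⊢
    rw [ih, hT]
    rfl

theorem TK_filter_rcons [∀ i, DecidableEq (M i)] {i j : Bool} (hij : i ≠ j)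
    (p : CoprodI.Word.Pair M i) :
    (CoprodI.Word.rcons p).toList.filter (fun l => l.1 = j) =
      p.tail.toList.filter (fun l => l.1 = j) := by
  unfold CoprodI.Word.rcons
  split_ifs with h
  · rfl
  · simp [CoprodI.Word.cons, hij]

theorem TK_filter_left {i j : Bool} (hij : i ≠ j) {L L' : List (Σ i, M i)} (h : TKRed L)
    (h' : TKRed L') (m : M i) (e : TKP L' = CoprodI.of m * TKP L) :
    L'.filter (fun l => l.1 = j) = L.filter (fun l => l.1 = j) := by
  classical
  let w : CoprodI.Word M := ⟨L, h.1, h.2⟩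
  let w' : CoprodI.Word M := ⟨L', h'.1, h'.2⟩
  have hw : w' = CoprodI.of m • w := by
    apply CoprodI.Word.equiv.symm.injective
    change w'.prod = (CoprodI.of m • w).prod
    rw [CoprodI.Word.prod_smul]
    exact e
  have h1 : w'.toList.filter (fun l => l.1 = j) = w.toList.filter (fun l => l.1 = j) := by
    rw [hw, CoprodI.Word.of_smul_def, TK_filter_rcons hij]
    conv_rhs => rw [← (CoprodI.Word.equivPair i).symm_apply_apply w, CoprodI.Word.equivPair_symm,
      TK_filter_rcons hij]
  exact h1

theorem TK_filter_map (j : Bool) (L : List (Σ i, M i)) :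
    (L.map TKinv).filter (fun l => l.1 = j) = (L.filter (fun l => l.1 = j)).map TKinv := by
  rw [List.filter_map]; rfl

theorem TK_filter_right {i j : Bool} (hij : i ≠ j) {L L' : List (Σ i, M i)} (h : TKRed L)
    (h' : TKRed L') (m : M i) (e : TKP L' = TKP L * CoprodI.of m) :
    L'.filter (fun l => l.1 = j) = L.filter (fun l => l.1 = j) := by
  have := TK_filter_left hij (TK_red_rev (TK_red_inv h)) (TK_red_rev (TK_red_inv h')) m⁻¹
    (by rw [TKP_inv, TKP_inv, e]; simp)
  rw [List.filter_reverse, List.filter_reverse, TK_filter_map, TK_filter_map] at this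
  exact List.map_injective_iff.2 TKinv_inj (List.reverse_injective this)

theorem TK_base {i j : Bool} (hij : i ≠ j) (hodd : ∀ m : M j, m * m = 1 → m = 1)
    (T : CoprodI M →* CoprodI M)
    (hT : ∀ i (m : M i), T (CoprodI.of m) = CoprodI.of m⁻¹)
    (w : M i) (h : CoprodI M) (e : CoprodI.of w * T h = h * CoprodI.of w) :
    ∃ (k : Bool) (m : M k), h = CoprodI.of m := by
  obtain ⟨L, hL, rfl⟩ := TK_exists_red h
  obtain ⟨K, hK, hKe⟩ := TK_exists_red (TKP L * CoprodI.of w)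
  have h1 := TK_filter_right hij hL hK w hKe
  have h2 := TK_filter_left hij (TK_red_inv hL) hK w (by rw [hKe, ← e, TKP_T T hT])
  rw [h1, TK_filter_map] at h2
  have h3 : ∀ l ∈ L, l.1 ≠ j := by
    rintro ⟨k, m⟩ hl hk
    simp only at hk
    subst hk
    have hmem : (⟨k, m⟩ : Σ i, M i) ∈ L.filter (fun l => l.1 = k) := by simp [hl]
    have h4 : ∀ l ∈ L.filter (fun l => l.1 = k), TKinv l = l := by
      have := (List.map_id (L.filter (fun l => l.1 = k))).trans h2
      intro l hl
      exact (List.map_inj_left.1 this l hl).symm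
    have h5 := h4 _ hmem
    simp only [TKinv, Sigma.mk.injEq, heq_eq_eq, true_and] at h5
    exact hL.1 _ hl (hodd m (by nth_rewrite 1 [← h5]; simp))
  match L, hL, h3 with
  | [], _, _ => exact ⟨i, 1, by simp [TKP]⟩
  | [a], _, _ => exact ⟨a.1, a.2, by simp [TKP]⟩
  | a :: b :: L, hL, h3 =>
    exfalso
    have ha := h3 a (by simp)
    have hb := h3 b (by simp)
    have hab := hL.2
    rw [List.isChain_cons_cons] at hab
    have := hab.1
    revert ha hb this
    generalize a.1 = x; generalize b.1 = y
    clear * -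
    revert x y j; decide

theorem TK_red_mid {x : Σ i, M i} {l : List (Σ i, M i)} (h : TKRed (x :: (l ++ [x]))) :
    TKRed l := by
  refine ⟨fun a ha => h.1 a (by simp [ha]), ?_⟩
  exact (List.isChain_append.1 h.2.tail).1

theorem TK_pal {i j : Bool} (hij : i ≠ j) (hodd : ∀ m : M j, m * m = 1 → m = 1)
    (hsq : ∀ m : M j, ∃ v, v * v = m)
    (T : CoprodI M →* CoprodI M)
    (hT : ∀ i (m : M i), T (CoprodI.of m) = CoprodI.of m⁻¹)
    (L : List (Σ i, M i)) (hp : L.Palindrome) :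
    ∀ h : CoprodI M, TKP L * T h = h * TKP L →
    ∃ (u : CoprodI M) (k : Bool) (m : M k), h = u * CoprodI.of m * u⁻¹ := by
  have key : ∀ (k : Bool) (x : M k) (g : CoprodI M),
      (∀ h : CoprodI M, g * T h = h * g →
        ∃ (u : CoprodI M) (k : Bool) (m : M k), h = u * CoprodI.of m * u⁻¹) →
      ∀ h : CoprodI M, (CoprodI.of x * g * CoprodI.of x) * T h =
        h * (CoprodI.of x * g * CoprodI.of x) →
        ∃ (u : CoprodI M) (k : Bool) (m : M k), h = u * CoprodI.of m * u⁻¹ := by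
    intro k x g ih h e
    obtain ⟨u, k', m, hu⟩ := ih ((CoprodI.of x)⁻¹ * h * CoprodI.of x) (by
      simp only [map_mul, map_inv, hT]
      simp only [inv_inv]
      have : g * CoprodI.of x * T h = (CoprodI.of x)⁻¹ * (h * (CoprodI.of x * g * CoprodI.of x)) := by
        rw [← e]; group
      rw [← mul_assoc, ← mul_assoc, this]; group)
    refine ⟨CoprodI.of x * u, k', m, ?_⟩
    have : h = CoprodI.of x * ((CoprodI.of x)⁻¹ * h * CoprodI.of x) * (CoprodI.of x)⁻¹ := by group
    rw [this, hu]; group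
  have one : ∀ h : CoprodI M, 1 * T h = h * 1 →
      ∃ (u : CoprodI M) (k : Bool) (m : M k), h = u * CoprodI.of m * u⁻¹ := by
    intro h e
    obtain ⟨k, m, hm⟩ := TK_base hij hodd T hT (1 : M i) h (by simpa using e)
    exact ⟨1, k, m, by simp [hm]⟩
  induction hp with
  | nil => simpa [TKP] using one
  | singleton x =>
    obtain ⟨k, x⟩ := x
    intro h e
    by_cases hk : k = j
    · subst hk
      obtain ⟨v, rfl⟩ := hsq x
      refine key k v 1 one h ?_
      simpa [TKP] using e
    · obtain ⟨k, m, hm⟩ := TK_base hk hodd T hT x h (by simpa [TKP] using e)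
      exact ⟨1, k, m, by simp [hm]⟩
  | cons_concat x hl ih =>
    intro h e
    refine key x.1 x.2 _ ih h ?_
    simpa [TKP, mul_assoc] using e

theorem TK_core {i j : Bool} (hij : i ≠ j) (hodd : ∀ m : M j, m * m = 1 → m = 1)
    (hsq : ∀ m : M j, ∃ v, v * v = m)
    (T : CoprodI M →* CoprodI M)
    (hT : ∀ i (m : M i), T (CoprodI.of m) = CoprodI.of m⁻¹)
    (g : CoprodI M) (hg : g * T g = 1)
    (h : CoprodI M) (e : g * T h = h * g) :
    ∃ (u : CoprodI M) (k : Bool) (m : M k), h = u * CoprodI.of m * u⁻¹ := by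
  obtain ⟨L, hL, rfl⟩ := TK_exists_red g
  refine TK_pal hij hodd hsq T hT L (List.Palindrome.of_reverse_eq ?_) h e
  have h1 : L.map TKinv = (L.map TKinv).reverse := by
    refine TK_red_inj (TK_red_inv hL) (TK_red_rev (TK_red_inv hL)) ?_
    rw [TKP_inv, TKP_T T hT]
    exact eq_inv_of_mul_eq_one_right hg
  rw [← List.map_reverse] at h1
  exact (List.map_injective_iff.2 TKinv_inj h1).symm

end Core

section Group

theorem TKG_mem (p q : ℕ) (H : Subgroup (TKG p q)) (hx : TKx p q ∈ H) (hy : TKy p q ∈ H)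
    (g : TKG p q) : g ∈ H := by
  refine PresentedGroup.generated_by _ H ?_ g
  intro b
  cases b
  · exact hy
  · exact hx

theorem TKG_ext {p q : ℕ} {H : Type*} [Group H] (a b : TKG p q →* H)
    (hx : a (TKx p q) = b (TKx p q)) (hy : a (TKy p q) = b (TKy p q)) (g : TKG p q) :
    a g = b g :=
  TKG_mem p q (a.eqLocus b) hx hy g

theorem TKG_rel (p q : ℕ) : TKx p q ^ p = TKy p q ^ q := by
  have h := PresentedGroup.mk_eq_mk_of_mul_inv_mem
    (rels := ({FreeGroup.of true ^ p * (FreeGroup.of false ^ q)⁻¹} : Set (FreeGroup Bool)))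
    (x := FreeGroup.of true ^ p) (y := FreeGroup.of false ^ q) rfl
  rw [map_pow, map_pow] at h
  exact h

theorem TKG_lift {p q : ℕ} {H : Type*} [Group H] (a b : H) (hab : a ^ p = b ^ q) :
    ∃ f : TKG p q →* H, f (TKx p q) = a ∧ f (TKy p q) = b := by
  have h : ∀ r ∈ ({FreeGroup.of true ^ p * (FreeGroup.of false ^ q)⁻¹} : Set (FreeGroup Bool)),
      FreeGroup.lift (fun c : Bool => cond c a b) r = 1 := by
    rintro r rfl
    simp [hab]
  exact ⟨(PresentedGroup.toGroup h : PresentedGroup _ →* H), PresentedGroup.toGroup.of h,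
    PresentedGroup.toGroup.of h⟩

/-- generators indexed by booleans -/
def TKgen (p q : ℕ) (b : Bool) : TKG p q := cond b (TKx p q) (TKy p q)

/-- exponents indexed by booleans -/
abbrev TKn (p q : ℕ) (b : Bool) : ℕ := cond b p q

/-- the factors -/
def TKM (p q : ℕ) (b : Bool) : Type := Multiplicative (ZMod (TKn p q b))

instance TKM.instCommGroup (p q : ℕ) (b : Bool) : CommGroup (TKM p q b) :=
  inferInstanceAs (CommGroup (Multiplicative (ZMod (TKn p q b))))

/-- the generators of the factors -/
def TKe (p q : ℕ) (b : Bool) : TKM p q b := Multiplicative.ofAdd (1 : ZMod (TKn p q b))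

theorem TKgen_pow (p q : ℕ) (b : Bool) : TKgen p q b ^ TKn p q b = TKx p q ^ p := by
  cases b
  · exact (TKG_rel p q).symm
  · rfl

theorem TKz_central (p q : ℕ) : TKx p q ^ p ∈ Subgroup.center (TKG p q) := by
  rw [Subgroup.mem_center_iff]
  intro g
  have := TKG_mem p q (Subgroup.centralizer {TKx p q ^ p}) ?_ ?_ g
  · rw [Subgroup.mem_centralizer_singleton_iff] at this
    exact this
  · rw [Subgroup.mem_centralizer_singleton_iff]
    exact (Commute.self_pow _ _).eq
  · rw [Subgroup.mem_centralizer_singleton_iff, TKG_rel]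
    exact (Commute.self_pow _ _).eq

theorem TKzmod_zpow {n : ℕ} (m : Multiplicative (ZMod n)) :
    ∃ k : ℤ, m = (Multiplicative.ofAdd (1 : ZMod n)) ^ k := by
  obtain ⟨k, hk⟩ := ZMod.intCast_surjective (Multiplicative.toAdd m)
  refine ⟨k, ?_⟩
  apply Multiplicative.toAdd.injective
  rw [← hk]
  simp

theorem TKzmod_pow {n : ℕ} (m : Multiplicative (ZMod n)) : m ^ n = 1 := by
  apply Multiplicative.toAdd.injective
  simp

theorem TKM_zpow {p q : ℕ} {b : Bool} (m : TKM p q b) : ∃ k : ℤ, m = TKe p q b ^ k :=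
  TKzmod_zpow (n := TKn p q b) m

theorem TKM_pow {p q : ℕ} {b : Bool} (m : TKM p q b) : m ^ TKn p q b = 1 :=
  TKzmod_pow (n := TKn p q b) m

theorem TKM_lift {n : ℕ} {H : Type*} [Group H] (a : H) (ha : a ^ n = 1) :
    ∃ f : Multiplicative (ZMod n) →* H, f (Multiplicative.ofAdd 1) = a := by
  let F : ℤ →+ Additive H := zmultiplesHom (Additive H) (Additive.ofMul a)
  have hF : F n = 0 := by
    simp [F, zmultiplesHom_apply, ← ofMul_pow, ha]
  refine ⟨AddMonoidHom.toMultiplicativeLeft (ZMod.lift n ⟨F, hF⟩), ?_⟩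
  have := ZMod.lift_coe n ⟨F, hF⟩ 1
  have h2 : F 1 = Additive.ofMul a := by simp [F, zmultiplesHom_apply]
  rw [Int.cast_one] at this
  exact this.trans h2

end Group

/-- main -/
theorem TKG_main (p q : ℕ) (hp : 2 ≤ p) (hq : 2 ≤ q)
    (hodd : Odd p ∨ Odd q)
    (τ : MulAut (TKG p q))
    (hτx : τ (TKx p q) = (TKx p q)⁻¹) (hτy : τ (TKy p q) = (TKy p q)⁻¹)
    (g : TKG p q) (hfin : g * τ g = 1) :
    ∀ h : TKG p q, g * τ h * g⁻¹ = h → h = 1 := by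
  intro h hh
  -- the projection to the free product
  obtain ⟨f, hfx, hfy⟩ := TKG_lift (p := p) (q := q)
    (CoprodI.of (TKe p q true))
    (CoprodI.of (TKe p q false))
    (by
      have h1 := TKM_pow (TKe p q true)
      have h2 := TKM_pow (TKe p q false)
      simp only [TKn, cond_true, cond_false] at h1 h2
      rw [← map_pow, ← map_pow, h1, h2, map_one, map_one])
  have hf : ∀ b, f (TKgen p q b) = CoprodI.of (TKe p q b) := by
    intro b; cases b
    · exact hfy
    · exact hfx
  have hfk : ∀ b (m : TKM p q b), ∃ k : ℤ, CoprodI.of m = f (TKgen p q b ^ k) := by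
    intro b m
    obtain ⟨k, rfl⟩ := TKM_zpow m
    exact ⟨k, by rw [map_zpow, map_zpow, hf]⟩
  have hsurj : Function.Surjective f := by
    intro u
    induction u using CoprodI.induction_on with
    | one => exact ⟨1, map_one f⟩
    | of i m => obtain ⟨k, hk⟩ := hfk _ m; exact ⟨_, hk.symm⟩
    | mul a b ha hb =>
      obtain ⟨a, rfl⟩ := ha
      obtain ⟨b, rfl⟩ := hb
      exact ⟨a * b, map_mul _ _ _⟩
  -- the kernel
  have hker : ∀ a, f a = 1 → a ∈ Subgroup.zpowers (TKx p q ^ p) := by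
    have hle : Subgroup.zpowers (TKx p q ^ p) ≤ Subgroup.center (TKG p q) := by
      rw [Subgroup.zpowers_le]; exact TKz_central p q
    have hN : (Subgroup.zpowers (TKx p q ^ p)).Normal := by
      constructor
      intro n hn c
      rw [Subgroup.mem_center_iff.1 (hle hn) c]
      simpa using hn
    have hl : ∀ b, ∃ s : TKM p q b →* TKG p q ⧸ Subgroup.zpowers (TKx p q ^ p),
        s (TKe p q b) = QuotientGroup.mk' _ (TKgen p q b) := by
      intro b
      apply TKM_lift (n := TKn p q b)
      rw [← map_pow, TKgen_pow]
      exact (QuotientGroup.eq_one_iff _).2 (Subgroup.mem_zpowers _)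
    choose s hs using hl
    have hcomp : ∀ a, ((CoprodI.lift s).comp f) a = QuotientGroup.mk' _ a := by
      apply TKG_ext
      · rw [MonoidHom.comp_apply, hfx, CoprodI.lift_of]; exact hs true
      · rw [MonoidHom.comp_apply, hfy, CoprodI.lift_of]; exact hs false
    intro a ha
    have := hcomp a
    rw [MonoidHom.comp_apply, ha, map_one] at this
    exact (QuotientGroup.eq_one_iff _).1 this.symm
  -- the degree
  obtain ⟨D, hDx, hDy⟩ := TKG_lift (p := p) (q := q)
    (Multiplicative.ofAdd (q : ℤ)) (Multiplicative.ofAdd (p : ℤ))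
    (by apply Multiplicative.toAdd.injective; simp [mul_comm])
  have hDτ : ∀ a, D (τ a) = (D a)⁻¹ := by
    intro a
    exact TKG_ext (D.comp τ.toMonoidHom) ((invMonoidHom).comp D)
      (by simp [hτx]) (by simp [hτy]) a
  have hDh : Multiplicative.toAdd (D h) = 0 := by
    have := congrArg (fun a => Multiplicative.toAdd (D a)) hh
    simp [hDτ] at this
    omega
  -- the induced map
  let T : CoprodI (TKM p q) →* CoprodI (TKM p q) :=
    CoprodI.lift (fun i => (CoprodI.of).comp (invMonoidHom))
  have hT : ∀ i (m : TKM p q i), T (CoprodI.of m) = CoprodI.of m⁻¹ := by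
    intro i m
    simp only [T, CoprodI.lift_of]; rfl
  have hfτ : ∀ a, f (τ a) = T (f a) := by
    intro a
    exact TKG_ext (f.comp τ.toMonoidHom) (T.comp f)
      (by simp [hτx, hfx, hT]) (by simp [hτy, hfy, hT]) a
  have hg' : f g * T (f g) = 1 := by rw [← hfτ, ← map_mul, hfin, map_one]
  have hh' : f g * T (f h) = f h * f g := by
    rw [← hfτ, ← map_mul, ← map_mul]
    congr 1
    conv_rhs => rw [← hh]
    group
  obtain ⟨i, j, hij, hj⟩ : ∃ i j : Bool, i ≠ j ∧ Odd (TKn p q j) := by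
    rcases hodd with h | h
    · exact ⟨false, true, by decide, h⟩
    · exact ⟨true, false, by decide, h⟩
  obtain ⟨c, hc⟩ := hj
  obtain ⟨u, b, m, hu⟩ := TK_core hij (fun m hm => by
      have := TKM_pow m
      rw [hc, pow_succ, pow_mul, pow_two, hm, one_pow, one_mul] at this
      exact this) (fun m => ⟨m ^ (c + 1), by
      have := TKM_pow m
      rw [hc] at this
      rw [← pow_add, show c + 1 + (c + 1) = 2 * c + 1 + 1 by ring, pow_succ, this, one_mul]⟩)
    T hT (f g) hg' (f h) hh'
  obtain ⟨u, rfl⟩ := hsurj u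
  obtain ⟨k, hk⟩ := hfk _ m
  have hmem := hker (u⁻¹ * h * u * (TKgen p q b ^ k)⁻¹) (by
    simp only [map_mul, map_inv]
    rw [hu, hk]; group)
  obtain ⟨l, hl⟩ := Subgroup.mem_zpowers_iff.1 hmem
  rw [← TKgen_pow p q b, ← zpow_natCast, ← zpow_mul, eq_mul_inv_iff_mul_eq, ← zpow_add] at hl
  have hD := congrArg (fun a => Multiplicative.toAdd (D a)) hl
  simp [hDh] at hD
  have hDg : Multiplicative.toAdd (D (TKgen p q b)) ≠ 0 := by
    cases b
    · simp [TKgen, hDy]; omega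
    · simp [TKgen, hDx]; omega
  have he : (TKn p q b : ℤ) * l + k = 0 := by
    rcases hD with hD | hD
    · exact hD
    · exact absurd hD hDg
  rw [he, zpow_zero] at hl
  have : h = u * (u⁻¹ * h * u) * u⁻¹ := by group
  rw [this, ← hl]; group

end TKAux

/-- If `p` or `q` is odd and `g·τ(g) = 1` (i.e. `ι_g ∘ τ` has finite order), then the
fixed subgroup of `ι_g ∘ τ` is trivial. -/
theorem TKG_fix_tau_g_trivial_of_odd (p q : ℕ) (hp : 2 ≤ p) (hq : 2 ≤ q)
    (hodd : Odd p ∨ Odd q)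
    (τ : MulAut (TKG p q))
    (hτx : τ (TKx p q) = (TKx p q)⁻¹) (hτy : τ (TKy p q) = (TKy p q)⁻¹)
    (g : TKG p q) (hfin : g * τ g = 1) :
    ∀ h : TKG p q, g * τ h * g⁻¹ = h → h = 1 := by
  exact TKG_main p q hp hq hodd τ hτx hτy g hfin
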